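/- arXiv:2507.05909 — 2 statements merged into one kernel-verified Lean document; each statement's English description precedes it below -/
import Mathlib

section
/- Let K be a field of characteristic zero and let g be a finite-dimensional Lie algebra over K. Then there exists a commutative K-bialgebra B together with a coaction η : g → B ⊗ g of B on g such that: (i) the pair (B, η) (with B regarded as a commutative algebra) is a universal pair for (g, g); and (ii) for every commutative K-bialgebra C and every coaction ψ : g → C ⊗ g of C on g, there exists a unique bialgebra homomorphism Φ : B → C with ψ = (Φ ⊗ id_g) ∘ η. -/
/-!
Statement 6: Let `g` be a finite-dimensional Lie algebra over a field `K` of characteristic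
zero. Then there exists a commutative `K`-bialgebra `B` with a coaction `η : g → B ⊗ g` such
that (i) `(B, η)` is a universal pair for `(g, g)`, and (ii) for every commutative
`K`-bialgebra `C` and every coaction `ψ : g → C ⊗ g` there is a unique bialgebra homomorphism
`Φ : B → C` with `ψ = (Φ ⊗ id_g) ∘ η`.
-/

open TensorProduct

universe u

/-- The base-change Lie bracket on `A ⊗[K] g` is `K`-bilinear, so `A ⊗[K] g` is a Lie algebra
over `K` (and not merely over `A`). -/
noncomputable instance baseChangeLieAlgebra {K : Type u} [Field K]
    {A : Type u} [CommRing A] [Algebra K A]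
    {L : Type u} [LieRing L] [LieAlgebra K L] : LieAlgebra K (A ⊗[K] L) :=
  { (inferInstance : Module K (A ⊗[K] L)) with
    lie_smul := fun t x y => by
      rw [← algebraMap_smul A t y, lie_smul, algebraMap_smul] }

/-- `(A, η)` is a universal pair for `(g, h)`. -/
def IsUniversalLiePair (K : Type u) [Field K]
    (g : Type u) [LieRing g] [LieAlgebra K g]
    (h : Type u) [LieRing h] [LieAlgebra K h]
    (A : Type u) [CommRing A] [Algebra K A]
    (η : h →ₗ⁅K⁆ A ⊗[K] g) : Prop :=
  ∀ (C : Type u) [CommRing C] [Algebra K C], ∀ f : h →ₗ⁅K⁆ C ⊗[K] g,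
    ∃! Φ : A →ₐ[K] C, ∀ x : h, f x = LinearMap.rTensor g Φ.toLinearMap (η x)

/-- A coaction of a commutative `K`-bialgebra `B` on the Lie algebra `g` is a Lie algebra
morphism `η : g → B ⊗ g` making `g` a `B`-comodule: `(ε_B ⊗ id) ∘ η = id` (up to the canonical
isomorphism `K ⊗ g ≅ g`) and `(Δ_B ⊗ id) ∘ η = (id_B ⊗ η) ∘ η` (up to associativity). -/
def IsLieCoaction (K : Type u) [Field K]
    (g : Type u) [LieRing g] [LieAlgebra K g]
    (B : Type u) [CommRing B] [Bialgebra K B]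
    (η : g →ₗ⁅K⁆ B ⊗[K] g) : Prop :=
  (∀ x : g, TensorProduct.lid K g
      (LinearMap.rTensor g (Coalgebra.counit (R := K) (A := B)) (η x)) = x) ∧
  ∀ x : g, LinearMap.rTensor g (Coalgebra.comul (R := K) (A := B)) (η x) =
    (TensorProduct.assoc K B B g).symm (LinearMap.lTensor B η.toLinearMap (η x))

/-- A universal coacting bialgebra of `g`: a commutative `K`-bialgebra `B` with a coaction
`η : g → B ⊗ g` which is a universal pair for `(g, g)` and is initial among coactions of
commutative bialgebras on `g`. -/
structure UniversalCoactingBialgebra (K : Type u) [Field K]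
    (g : Type u) [LieRing g] [LieAlgebra K g] : Type (u + 1) where
  B : Type u
  [commRingB : CommRing B]
  [bialgebraB : Bialgebra K B]
  η : g →ₗ⁅K⁆ B ⊗[K] g
  coaction : IsLieCoaction K g B η
  universal_alg : IsUniversalLiePair K g g B η
  universal_bialg : ∀ (C : Type u) [CommRing C] [Bialgebra K C], ∀ ψ : g →ₗ⁅K⁆ C ⊗[K] g,
    IsLieCoaction K g C ψ →
    ∃! Φ : B →ₐc[K] C, ∀ x : g, ψ x = LinearMap.rTensor g Φ.toLinearMap (η x)

open MvPolynomial

section Coefficients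

variable {K : Type u} [Field K] {g : Type u} [LieRing g] [LieAlgebra K g]
  {ι : Type u} (b : Module.Basis ι K g)

/-- The `i`-th coefficient of an element of `A ⊗ g` with respect to a basis of `g`. -/
noncomputable def tensorCoeff (A : Type u) [CommRing A] [Algebra K A] (i : ι) :
    A ⊗[K] g →ₗ[K] A :=
  (TensorProduct.rid K A).toLinearMap ∘ₗ LinearMap.lTensor A (b.coord i)

@[simp]
lemma tensorCoeff_tmul {A : Type u} [CommRing A] [Algebra K A] (i : ι) (a : A) (x : g) :
    tensorCoeff b A i (a ⊗ₜ x) = b.repr x i • a := by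
  simp [tensorCoeff]

lemma tensorCoeff_rTensor {A C : Type u} [CommRing A] [Algebra K A] [CommRing C] [Algebra K C]
    (f : A →ₗ[K] C) (i : ι) (z : A ⊗[K] g) :
    tensorCoeff b C i (LinearMap.rTensor g f z) = f (tensorCoeff b A i z) := by
  induction z with
  | zero => simp
  | tmul a x => simp
  | add x y hx hy => simp [hx, hy]

lemma sum_tensorCoeff_tmul [Fintype ι] {A : Type u} [CommRing A] [Algebra K A]
    (z : A ⊗[K] g) : ∑ i, tensorCoeff b A i z ⊗ₜ[K] b i = z := by
  induction z with
  | zero => simp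
  | tmul a x =>
    simp only [tensorCoeff_tmul, TensorProduct.smul_tmul, ← TensorProduct.tmul_sum, b.sum_repr]
  | add x y hx hy => simp [TensorProduct.add_tmul, Finset.sum_add_distrib, hx, hy]

lemma tensorCoeff_ext [Fintype ι] {A : Type u} [CommRing A] [Algebra K A] {z w : A ⊗[K] g}
    (h : ∀ i, tensorCoeff b A i z = tensorCoeff b A i w) : z = w := by
  rw [← sum_tensorCoeff_tmul b z, ← sum_tensorCoeff_tmul b w]
  simp [h]

lemma tensorCoeff_sum_tmul [Fintype ι] {A : Type u} [CommRing A] [Algebra K A]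
    (c : ι → A) (i : ι) : tensorCoeff b A i (∑ j, c j ⊗ₜ[K] b j) = c i := by
  classical
  simp [Finsupp.single_apply]

end Coefficients

section Brackets

variable {K : Type u} [Field K] {g : Type u} [LieRing g] [LieAlgebra K g]

lemma rTensor_algHom_lie {A C : Type u} [CommRing A] [Algebra K A] [CommRing C] [Algebra K C]
    (Φ : A →ₐ[K] C) (z w : A ⊗[K] g) :
    LinearMap.rTensor g Φ.toLinearMap ⁅z, w⁆ =
      ⁅LinearMap.rTensor g Φ.toLinearMap z, LinearMap.rTensor g Φ.toLinearMap w⁆ := by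
  induction z with
  | zero => simp
  | add x y hx hy => simp only [add_lie, map_add, hx, hy]
  | tmul a x =>
    induction w with
    | zero => simp
    | add x y hx hy => simp only [lie_add, map_add, hx, hy]
    | tmul c y => simp

/-- The linear map `A ⊗ (C ⊗ g) → D ⊗ g` sending `a ⊗ (c ⊗ x)` to `(i₁ a * i₂ c) ⊗ x`. -/
noncomputable def tensorMerge (g : Type u) [LieRing g] [LieAlgebra K g]
    {A C D : Type u} [CommRing A] [Algebra K A] [CommRing C] [Algebra K C]
    [CommRing D] [Algebra K D] (i₁ : A →ₐ[K] D) (i₂ : C →ₐ[K] D) :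
    A ⊗[K] (C ⊗[K] g) →ₗ[K] D ⊗[K] g :=
  TensorProduct.lift
    (LinearMap.rTensorHom g ∘ₗ (LinearMap.mul K D).compl₁₂ i₁.toLinearMap i₂.toLinearMap)

section Merge

variable {A C D : Type u} [CommRing A] [Algebra K A] [CommRing C] [Algebra K C]
  [CommRing D] [Algebra K D] (i₁ : A →ₐ[K] D) (i₂ : C →ₐ[K] D)

@[simp]
lemma tensorMerge_tmul_tmul (a : A) (c : C) (x : g) :
    tensorMerge g i₁ i₂ (a ⊗ₜ (c ⊗ₜ x)) = (i₁ a * i₂ c) ⊗ₜ x := by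
  simp [tensorMerge]

lemma tensorMerge_tmul_lie (a a' : A) (z w : C ⊗[K] g) :
    tensorMerge g i₁ i₂ ((a * a') ⊗ₜ ⁅z, w⁆) =
      ⁅tensorMerge g i₁ i₂ (a ⊗ₜ z), tensorMerge g i₁ i₂ (a' ⊗ₜ w)⁆ := by
  induction z with
  | zero => simp
  | add x y hx hy => simp only [TensorProduct.tmul_add, add_lie, map_add, hx, hy]
  | tmul c x =>
    induction w with
    | zero => simp
    | add x y hx hy => simp only [TensorProduct.tmul_add, lie_add, map_add, hx, hy]
    | tmul d y => simp [mul_mul_mul_comm]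

lemma tensorMerge_lTensor_lie {h : Type u} [LieRing h] [LieAlgebra K h]
    (f : h →ₗ⁅K⁆ C ⊗[K] g) (z w : A ⊗[K] h) :
    tensorMerge g i₁ i₂ (LinearMap.lTensor A f.toLinearMap ⁅z, w⁆) =
      ⁅tensorMerge g i₁ i₂ (LinearMap.lTensor A f.toLinearMap z),
        tensorMerge g i₁ i₂ (LinearMap.lTensor A f.toLinearMap w)⁆ := by
  induction z with
  | zero => simp
  | add x y hx hy => simp only [add_lie, map_add, hx, hy]
  | tmul a x =>
    induction w with
    | zero => simp
    | add x y hx hy => simp only [lie_add, map_add, hx, hy]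
    | tmul c y =>
      simp only [LieAlgebra.ExtendScalars.bracket_tmul, LinearMap.lTensor_tmul,
        tensorMerge_tmul_lie, LieHom.coe_toLinearMap, LieHom.map_lie]

/-- The composite of two Lie algebra morphisms `h' → A ⊗ h` and `h → C ⊗ g`, with
coefficients multiplied in a common algebra `D`. -/
noncomputable def lieTensorComp {h h' : Type u} [LieRing h] [LieAlgebra K h]
    [LieRing h'] [LieAlgebra K h'] (f' : h →ₗ⁅K⁆ C ⊗[K] g) (f : h' →ₗ⁅K⁆ A ⊗[K] h) :
    h' →ₗ⁅K⁆ D ⊗[K] g where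
  toLinearMap := tensorMerge g i₁ i₂ ∘ₗ LinearMap.lTensor A f'.toLinearMap ∘ₗ f.toLinearMap
  map_lie' {x y} := by
    simp [tensorMerge_lTensor_lie]

lemma lieTensorComp_apply {h h' : Type u} [LieRing h] [LieAlgebra K h]
    [LieRing h'] [LieAlgebra K h'] (f' : h →ₗ⁅K⁆ C ⊗[K] g) (f : h' →ₗ⁅K⁆ A ⊗[K] h) (x : h') :
    lieTensorComp i₁ i₂ f' f x =
      tensorMerge g i₁ i₂ (LinearMap.lTensor A f'.toLinearMap (f x)) :=
  rfl

end Merge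

/-- The canonical Lie algebra morphism `g → K ⊗ g`. -/
noncomputable def lieUnitTensor (K : Type u) [Field K] (g : Type u) [LieRing g]
    [LieAlgebra K g] : g →ₗ⁅K⁆ K ⊗[K] g where
  toLinearMap := (TensorProduct.lid K g).symm.toLinearMap
  map_lie' {x y} := by simp

end Brackets

section UniversalAlgebra

variable {K : Type u} [Field K] {g : Type u} [LieRing g] [LieAlgebra K g]
  {h : Type u} [LieRing h] [LieAlgebra K h] {ι κ : Type u} [Fintype ι]
  (b : Module.Basis ι K g) (bh : Module.Basis κ K h)

/-- The generic linear map `h → K[X i j] ⊗ g`. -/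
noncomputable def genericLinearMap : h →ₗ[K] MvPolynomial (ι × κ) K ⊗[K] g :=
  bh.constr K fun j => ∑ i, X (i, j) ⊗ₜ[K] b i

/-- The ideal of relations forcing the generic linear map to preserve brackets. -/
noncomputable def lieRelations : Ideal (MvPolynomial (ι × κ) K) :=
  Ideal.span {p | ∃ (x y : h) (i : ι), p = tensorCoeff b _ i
    (genericLinearMap b bh ⁅x, y⁆ - ⁅genericLinearMap b bh x, genericLinearMap b bh y⁆)}

/-- The universal algebra of a pair of Lie algebras with chosen bases. -/
def UniversalLieAlg : Type u := MvPolynomial (ι × κ) K ⧸ lieRelations b bh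

noncomputable instance : CommRing (UniversalLieAlg b bh) :=
  inferInstanceAs (CommRing (MvPolynomial (ι × κ) K ⧸ lieRelations b bh))

noncomputable instance : Algebra K (UniversalLieAlg b bh) :=
  inferInstanceAs (Algebra K (MvPolynomial (ι × κ) K ⧸ lieRelations b bh))

/-- The quotient map from the polynomial algebra onto the universal algebra. -/
noncomputable def universalLieAlgMk : MvPolynomial (ι × κ) K →ₐ[K] UniversalLieAlg b bh :=
  Ideal.Quotient.mkₐ K (lieRelations b bh)

/-- The `(i, j)`-th matrix coefficient in the universal algebra. -/
noncomputable def universalLieAlgGen (i : ι) (j : κ) : UniversalLieAlg b bh :=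
  universalLieAlgMk b bh (X (i, j))

/-- The universal Lie algebra morphism. -/
noncomputable def universalLieHom : h →ₗ⁅K⁆ UniversalLieAlg b bh ⊗[K] g where
  toLinearMap := LinearMap.rTensor g (universalLieAlgMk b bh).toLinearMap ∘ₗ
    genericLinearMap b bh
  map_lie' {x y} := by
    rw [← sub_eq_zero]
    refine tensorCoeff_ext b fun i => ?_
    simp only [AddHom.toFun_eq_coe, LinearMap.coe_toAddHom, LinearMap.comp_apply]
    rw [← rTensor_algHom_lie, ← map_sub, tensorCoeff_rTensor, map_zero]
    exact Ideal.Quotient.eq_zero_iff_mem.mpr (Ideal.subset_span ⟨x, y, i, rfl⟩)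

lemma universalLieHom_basis (j : κ) :
    universalLieHom b bh (bh j) = ∑ i, universalLieAlgGen b bh i j ⊗ₜ[K] b i := by
  change LinearMap.rTensor g _ (genericLinearMap b bh (bh j)) = _
  simp [genericLinearMap, Module.Basis.constr_basis, universalLieAlgGen]

variable {b bh} in
lemma universalLieAlg_algHom_ext {C : Type u} [CommRing C] [Algebra K C]
    {Φ Ψ : UniversalLieAlg b bh →ₐ[K] C}
    (H : ∀ i j, Φ (universalLieAlgGen b bh i j) = Ψ (universalLieAlgGen b bh i j)) : Φ = Ψ :=
  Ideal.Quotient.algHom_ext K (MvPolynomial.algHom_ext fun p => H p.1 p.2)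

theorem isUniversalLiePair_universalLieHom :
    IsUniversalLiePair K g h (UniversalLieAlg b bh) (universalLieHom b bh) := by
  intro C _ _ f
  let F : MvPolynomial (ι × κ) K →ₐ[K] C := aeval fun p => tensorCoeff b C p.1 (f (bh p.2))
  have hF : LinearMap.rTensor g F.toLinearMap ∘ₗ genericLinearMap b bh = f.toLinearMap := by
    refine bh.ext fun j => ?_
    simp [genericLinearMap, Module.Basis.constr_basis, F, sum_tensorCoeff_tmul]
  have hF' (x : h) : LinearMap.rTensor g F.toLinearMap (genericLinearMap b bh x) = f x :=
    LinearMap.congr_fun hF x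
  have hI : ∀ p ∈ lieRelations b bh, F p = 0 := by
    intro p hp
    refine (Ideal.span_le (I := RingHom.ker F)).mpr ?_ hp
    rintro _ ⟨x, y, i, rfl⟩
    change F.toLinearMap _ = 0
    rw [← tensorCoeff_rTensor, map_sub, rTensor_algHom_lie, hF', hF', hF', LieHom.map_lie,
      sub_self, map_zero]
  refine ⟨Ideal.Quotient.liftₐ _ F hI, fun x => ?_, fun Ψ hΨ => ?_⟩
  · change f x = LinearMap.rTensor g _ (LinearMap.rTensor g _ (genericLinearMap b bh x))
    rw [← LinearMap.comp_apply, ← LinearMap.rTensor_comp, ← hF' x]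
    rfl
  · refine universalLieAlg_algHom_ext fun i j => ?_
    have key : tensorCoeff b C i (f (bh j)) = Ψ (universalLieAlgGen b bh i j) := by
      rw [hΨ, tensorCoeff_rTensor, universalLieHom_basis, tensorCoeff_sum_tmul]
      rfl
    rw [← key]
    change _ = F (X (i, j))
    simp [F]

/-- The algebra morphism classifying a Lie algebra morphism `h → C ⊗ g`. -/
noncomputable def universalLieLift {C : Type u} [CommRing C] [Algebra K C]
    (f : h →ₗ⁅K⁆ C ⊗[K] g) : UniversalLieAlg b bh →ₐ[K] C :=
  (isUniversalLiePair_universalLieHom b bh C f).choose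

lemma universalLieLift_spec {C : Type u} [CommRing C] [Algebra K C]
    (f : h →ₗ⁅K⁆ C ⊗[K] g) (x : h) :
    f x = LinearMap.rTensor g (universalLieLift b bh f).toLinearMap (universalLieHom b bh x) :=
  (isUniversalLiePair_universalLieHom b bh C f).choose_spec.1 x

lemma eq_sum_of_eq_rTensor_universalLieHom {C : Type u} [CommRing C] [Algebra K C]
    {f : h →ₗ⁅K⁆ C ⊗[K] g} {Φ : UniversalLieAlg b bh →ₗ[K] C}
    (H : ∀ x, f x = LinearMap.rTensor g Φ (universalLieHom b bh x)) (j : κ) :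
    f (bh j) = ∑ i, Φ (universalLieAlgGen b bh i j) ⊗ₜ[K] b i := by
  simp [H, universalLieHom_basis]

lemma universalLieLift_gen {C : Type u} [CommRing C] [Algebra K C]
    (f : h →ₗ⁅K⁆ C ⊗[K] g) (i : ι) (j : κ) :
    universalLieLift b bh f (universalLieAlgGen b bh i j) = tensorCoeff b C i (f (bh j)) := by
  rw [eq_sum_of_eq_rTensor_universalLieHom b bh (universalLieLift_spec b bh f) j,
    tensorCoeff_sum_tmul]
  rfl

end UniversalAlgebra

section Bialgebra

variable {K : Type u} [Field K] {g : Type u} [LieRing g] [LieAlgebra K g]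
  {ι : Type u} [Fintype ι] (b : Module.Basis ι K g)

/-- A Lie algebra morphism is a coaction exactly when its matrix coefficients satisfy
`ε (c i j) = δ i j` and `Δ (c k j) = ∑ i, c i j ⊗ c k i`. -/
lemma isLieCoaction_iff_coeff [DecidableEq ι] {B : Type u} [CommRing B] [Bialgebra K B]
    {η : g →ₗ⁅K⁆ B ⊗[K] g} {c : ι → ι → B} (hc : ∀ j, η (b j) = ∑ i, c i j ⊗ₜ[K] b i) :
    IsLieCoaction K g B η ↔
      (∀ i j, Coalgebra.counit (R := K) (c i j) = if i = j then 1 else 0) ∧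
      ∀ k j, Coalgebra.comul (R := K) (c k j) = ∑ i, c i j ⊗ₜ[K] c k i := by
  have hcounit (j : ι) : LinearMap.rTensor g (Coalgebra.counit (R := K) (A := B)) (η (b j)) =
      ∑ i, Coalgebra.counit (R := K) (c i j) ⊗ₜ[K] b i := by simp [hc]
  have hcomul (j : ι) : LinearMap.rTensor g (Coalgebra.comul (R := K) (A := B)) (η (b j)) =
      ∑ k, Coalgebra.comul (R := K) (c k j) ⊗ₜ[K] b k := by simp [hc]
  have hiter (j : ι) : (TensorProduct.assoc K B B g).symm
      (LinearMap.lTensor B η.toLinearMap (η (b j))) =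
      ∑ k, (∑ i, c i j ⊗ₜ[K] c k i) ⊗ₜ[K] b k := by
    simp only [hc, map_sum, LinearMap.lTensor_tmul, LieHom.coe_toLinearMap,
      TensorProduct.tmul_sum, TensorProduct.assoc_symm_tmul, TensorProduct.sum_tmul]
    exact Finset.sum_comm
  refine ⟨fun ⟨h₁, h₂⟩ => ⟨fun i j => ?_, fun k j => ?_⟩,
    fun ⟨h₁, h₂⟩ => ⟨fun x => ?_, fun x => ?_⟩⟩
  · have := congrArg (fun z => b.repr z i) (h₁ (b j))
    simpa [hcounit, Finsupp.single_apply, eq_comm] using this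
  · have := congrArg (tensorCoeff b _ k) (h₂ (b j))
    rwa [hcomul, hiter, tensorCoeff_sum_tmul, tensorCoeff_sum_tmul] at this
  · suffices H : (TensorProduct.lid K g).toLinearMap ∘ₗ
        LinearMap.rTensor g (Coalgebra.counit (R := K) (A := B)) ∘ₗ η.toLinearMap =
        LinearMap.id from LinearMap.congr_fun H x
    refine b.ext fun j => ?_
    simp [hcounit, h₁]
  · suffices H : LinearMap.rTensor g (Coalgebra.comul (R := K) (A := B)) ∘ₗ η.toLinearMap =
        (TensorProduct.assoc K B B g).symm.toLinearMap ∘ₗ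
          LinearMap.lTensor B η.toLinearMap ∘ₗ η.toLinearMap from LinearMap.congr_fun H x
    refine b.ext fun j => ?_
    simp only [LinearMap.comp_apply, LieHom.coe_toLinearMap, LinearEquiv.coe_coe]
    rw [hcomul, hiter]
    simp [h₂]

/-- The counit of the universal algebra. -/
noncomputable def universalCounit : UniversalLieAlg b b →ₐ[K] K :=
  universalLieLift b b (lieUnitTensor K g)

/-- The comultiplication of the universal algebra. -/
noncomputable def universalComul :
    UniversalLieAlg b b →ₐ[K] UniversalLieAlg b b ⊗[K] UniversalLieAlg b b :=
  universalLieLift b b (lieTensorComp Algebra.TensorProduct.includeLeft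
    Algebra.TensorProduct.includeRight (universalLieHom b b) (universalLieHom b b))

lemma universalCounit_gen [DecidableEq ι] (i j : ι) :
    universalCounit b (universalLieAlgGen b b i j) = if i = j then 1 else 0 := by
  rw [universalCounit, universalLieLift_gen]
  change tensorCoeff b K i ((TensorProduct.lid K g).symm (b j)) = _
  simp [Finsupp.single_apply, eq_comm]

lemma universalComul_gen (k j : ι) :
    universalComul b (universalLieAlgGen b b k j) =
      ∑ i, universalLieAlgGen b b i j ⊗ₜ[K] universalLieAlgGen b b k i := by
  rw [universalComul, universalLieLift_gen, lieTensorComp_apply]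
  simp only [universalLieHom_basis, map_sum, LinearMap.lTensor_tmul, LieHom.coe_toLinearMap,
    TensorProduct.tmul_sum, tensorMerge_tmul_tmul]
  refine Finset.sum_congr rfl fun i _ => ?_
  rw [← map_sum, tensorCoeff_sum_tmul]
  simp

/-- The bialgebra structure on the universal algebra. -/
noncomputable instance universalLieBialgebra : Bialgebra K (UniversalLieAlg b b) :=
  Bialgebra.ofAlgHom (universalComul b) (universalCounit b)
    (universalLieAlg_algHom_ext fun i j => by
      simp [universalComul_gen, TensorProduct.sum_tmul, TensorProduct.tmul_sum]
      exact Finset.sum_comm)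
    (universalLieAlg_algHom_ext fun i j => by
      classical
      simp [universalComul_gen, universalCounit_gen, TensorProduct.ite_tmul])
    (universalLieAlg_algHom_ext fun i j => by
      classical
      simp [universalComul_gen, universalCounit_gen, TensorProduct.tmul_ite])

/-- A finite basis of `g` gives a universal coacting bialgebra of `g`. -/
noncomputable def universalCoactingBialgebraOfBasis : UniversalCoactingBialgebra K g := by
  classical exact
  { B := UniversalLieAlg b b
    η := universalLieHom b b
    coaction := (isLieCoaction_iff_coeff b (universalLieHom_basis b b)).mpr
      ⟨universalCounit_gen b, universalComul_gen b⟩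
    universal_alg := isUniversalLiePair_universalLieHom b b
    universal_bialg := by
      intro C _ _ ψ hψ
      obtain ⟨Φ, hΦ, huniq⟩ := isUniversalLiePair_universalLieHom b b C ψ
      obtain ⟨h₁, h₂⟩ := (isLieCoaction_iff_coeff b
        (eq_sum_of_eq_rTensor_universalLieHom b b hΦ)).mp hψ
      refine ⟨BialgHom.ofAlgHom Φ (universalLieAlg_algHom_ext fun i j => ?_)
        (universalLieAlg_algHom_ext fun i j => ?_), hΦ, fun Ψ hΨ => ?_⟩
      · exact (h₁ i j).trans (universalCounit_gen b i j).symm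
      · refine Eq.trans ?_ (h₂ i j).symm
        change Algebra.TensorProduct.map Φ Φ (universalComul b _) = _
        simp [universalComul_gen]
      · have := huniq (Ψ : UniversalLieAlg b b →ₐ[K] C) hΨ
        ext x
        exact DFunLike.congr_fun this x }

end Bialgebra

/-- Every finite-dimensional Lie algebra over a field of characteristic zero admits a
universal coacting bialgebra. -/
theorem exists_universalCoactingBialgebra
    (K : Type u) [Field K] [CharZero K]
    (g : Type u) [LieRing g] [LieAlgebra K g] [FiniteDimensional K g] :
    Nonempty (UniversalCoactingBialgebra K g) := by
  exact ⟨universalCoactingBialgebraOfBasis (Module.Free.chooseBasis K g)⟩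
end

section
/- Let K be a field of characteristic zero and let g be a finite-dimensional Lie algebra over K. Then there exists a commutative Hopf K-algebra H together with a coaction λ : g → H ⊗ g of H on g such that for every commutative Hopf K-algebra H' and every coaction ψ : g → H' ⊗ g of H' on g, there exists a unique bialgebra homomorphism Φ : H → H' with ψ = (Φ ⊗ id_g) ∘ λ. (A bialgebra homomorphism between Hopf algebras automatically preserves the antipode, so Φ is a Hopf algebra homomorphism.) -/
/-!
Statement 7: Let `g` be a finite-dimensional Lie algebra over a field `K` of characteristic
zero. Then there exists a commutative Hopf `K`-algebra `H` with a coaction `λ : g → H ⊗ g`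
such that for every commutative Hopf `K`-algebra `H'` and every coaction `ψ : g → H' ⊗ g`
there is a unique bialgebra homomorphism `Φ : H → H'` with `ψ = (Φ ⊗ id_g) ∘ λ`.
-/

open TensorProduct

universe u

/-- A universal coacting commutative Hopf algebra of the Lie algebra `g`. -/
structure UniversalCoactingHopfAlgebra (K : Type u) [Field K]
    (g : Type u) [LieRing g] [LieAlgebra K g] : Type (u + 1) where
  H : Type u
  [commRingH : CommRing H]
  [hopfAlgebraH : HopfAlgebra K H]
  lam : g →ₗ⁅K⁆ H ⊗[K] g
  coaction : IsLieCoaction K g H lam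
  universal : ∀ (H' : Type u) [CommRing H'] [HopfAlgebra K H'], ∀ ψ : g →ₗ⁅K⁆ H' ⊗[K] g,
    IsLieCoaction K g H' ψ →
    ∃! Φ : H →ₐc[K] H', ∀ x : g, ψ x = LinearMap.rTensor g Φ.toLinearMap (lam x)

namespace LieCoaction

variable {K g : Type u} [Field K] [LieRing g] [LieAlgebra K g]
  {A B : Type u} [CommRing A] [Algebra K A] [CommRing B] [Algebra K B]
  {ι : Type} (b : Module.Basis ι K g)

theorem rTensor_lie (f : A →ₐ[K] B) (x y : A ⊗[K] g) :
    LinearMap.rTensor g f.toLinearMap ⁅x, y⁆ =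
      ⁅LinearMap.rTensor g f.toLinearMap x, LinearMap.rTensor g f.toLinearMap y⁆ := by
  induction x with
  | zero => simp
  | add x₁ x₂ h₁ h₂ => simp only [add_lie, map_add, h₁, h₂]
  | tmul a u =>
    induction y with
    | zero => simp
    | add y₁ y₂ h₁ h₂ => simp only [lie_add, map_add, h₁, h₂]
    | tmul c v => simp [LieAlgebra.ExtendScalars.bracket_tmul]

theorem basis_repr_rTensor (f : A →ₐ[K] B) (z : A ⊗[K] g) (l : ι) :
    (Algebra.TensorProduct.basis B b).repr (LinearMap.rTensor g f.toLinearMap z) l =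
      f ((Algebra.TensorProduct.basis A b).repr z l) := by
  induction z with
  | zero => simp
  | add x₁ x₂ h₁ h₂ => simp only [map_add, Finsupp.add_apply, h₁, h₂]
  | tmul a u => simp [Algebra.TensorProduct.basis_repr_tmul]

variable [Fintype ι]

/-- The linear map `g → A ⊗ g` sending `b i` to `∑ j, M i j ⊗ b j`. -/
noncomputable def ofMatrix (M : Matrix ι ι A) : g →ₗ[K] A ⊗[K] g :=
  b.constr K fun i => ∑ j, M i j ⊗ₜ[K] b j

theorem ofMatrix_basis (M : Matrix ι ι A) (i : ι) :
    ofMatrix b M (b i) = ∑ j, M i j ⊗ₜ[K] b j :=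
  b.constr_basis K _ i

/-- The matrix of a linear map `g → A ⊗ g`. -/
noncomputable def toMatrix (η : g →ₗ[K] A ⊗[K] g) : Matrix ι ι A :=
  fun i j => (Algebra.TensorProduct.basis A b).repr (η (b i)) j

theorem ofMatrix_toMatrix (η : g →ₗ[K] A ⊗[K] g) : ofMatrix b (toMatrix b η) = η := by
  refine b.ext fun i => ?_
  rw [ofMatrix_basis]
  conv_rhs => rw [← (Algebra.TensorProduct.basis A b).sum_repr (η (b i))]
  simp [toMatrix, Algebra.TensorProduct.basis_apply, TensorProduct.smul_tmul']

theorem sum_tmul_basis_inj {v w : ι → A} :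
    ∑ j, v j ⊗ₜ[K] b j = ∑ j, w j ⊗ₜ[K] b j ↔ v = w := by
  have key (v : ι → A) :
      ∑ j, v j ⊗ₜ[K] b j = (Algebra.TensorProduct.basis A b).equivFun.symm v := by
    simp [Module.Basis.equivFun_symm_apply, Algebra.TensorProduct.basis_apply,
      TensorProduct.smul_tmul']
  rw [key, key, EmbeddingLike.apply_eq_iff_eq]

theorem ofMatrix_injective : Function.Injective (ofMatrix b : Matrix ι ι A → _) := by
  intro M N h
  ext i j
  have := LinearMap.congr_fun h (b i)
  rw [ofMatrix_basis, ofMatrix_basis, sum_tmul_basis_inj] at this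
  exact congr_fun this j

theorem rTensor_ofMatrix (f : A →ₗ[K] B) (M : Matrix ι ι A) (x : g) :
    LinearMap.rTensor g f (ofMatrix b M x) = ofMatrix b (M.map f) x := by
  refine LinearMap.congr_fun (f := (LinearMap.rTensor g f).comp (ofMatrix b M))
    (b.ext fun i => ?_) x
  simp [ofMatrix_basis]

theorem liftBaseChange_ofMatrix (M N : Matrix ι ι A) (x : g) :
    (ofMatrix b N).liftBaseChange A (ofMatrix b M x) = ofMatrix b (M * N) x := by
  refine LinearMap.congr_fun
    (f := (((ofMatrix b N).liftBaseChange A).restrictScalars K).comp (ofMatrix b M))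
    (b.ext fun i => ?_) x
  simp only [LinearMap.comp_apply, ofMatrix_basis, LinearMap.restrictScalars_apply, map_sum,
    LinearMap.liftBaseChange_tmul, Finset.smul_sum, TensorProduct.smul_tmul', smul_eq_mul,
    Matrix.mul_apply, TensorProduct.sum_tmul]
  exact Finset.sum_comm

variable (K) in
/-- The Lie bracket as a bilinear map. -/
def lieBilin (L : Type*) [LieRing L] [LieAlgebra K L] : L →ₗ[K] L →ₗ[K] L :=
  LinearMap.mk₂ K (fun x y => ⁅x, y⁆) add_lie smul_lie lie_add lie_smul

/-- `M` defines a Lie algebra morphism `g → A ⊗ g`. -/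
def IsLieMatrix (M : Matrix ι ι A) : Prop :=
  ∀ x y : g, ofMatrix b M ⁅x, y⁆ = ⁅ofMatrix b M x, ofMatrix b M y⁆

theorem isLieMatrix_iff (M : Matrix ι ι A) :
    IsLieMatrix b M ↔ ∀ i j l, (Algebra.TensorProduct.basis A b).repr
      (ofMatrix b M ⁅b i, b j⁆ - ⁅ofMatrix b M (b i), ofMatrix b M (b j)⁆) l = 0 := by
  constructor
  · intro h i j l
    simp [h (b i) (b j)]
  · intro h
    have hb (i j) : ofMatrix b M ⁅b i, b j⁆ = ⁅ofMatrix b M (b i), ofMatrix b M (b j)⁆ := by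
      rw [← sub_eq_zero, ← (Algebra.TensorProduct.basis A b).repr.map_eq_zero_iff]
      ext l
      exact h i j l
    exact LinearMap.congr_fun₂ (f := (lieBilin K g).compr₂ (ofMatrix b M))
      (g := (lieBilin K (A ⊗[K] g)).compl₁₂ (ofMatrix b M) (ofMatrix b M))
      (LinearMap.ext_basis b b hb)

theorem IsLieMatrix.liftBaseChange_lie {M : Matrix ι ι A} (hM : IsLieMatrix b M)
    (x y : A ⊗[K] g) :
    (ofMatrix b M).liftBaseChange A ⁅x, y⁆ =
      ⁅(ofMatrix b M).liftBaseChange A x, (ofMatrix b M).liftBaseChange A y⁆ := by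
  induction x with
  | zero => simp
  | add x₁ x₂ h₁ h₂ => simp only [add_lie, map_add, h₁, h₂]
  | tmul a u =>
    induction y with
    | zero => simp
    | add y₁ y₂ h₁ h₂ => simp only [lie_add, map_add, h₁, h₂]
    | tmul c v => simp [LieAlgebra.ExtendScalars.bracket_tmul, hM u v, mul_smul, smul_comm c a]

theorem IsLieMatrix.mul {M N : Matrix ι ι A} (hM : IsLieMatrix b M) (hN : IsLieMatrix b N) :
    IsLieMatrix b (M * N) := by
  intro x y
  simp only [← liftBaseChange_ofMatrix, hM x y, hN.liftBaseChange_lie]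

theorem IsLieMatrix.map {M : Matrix ι ι A} (hM : IsLieMatrix b M) (f : A →ₐ[K] B) :
    IsLieMatrix b (M.map f) := by
  intro x y
  simp only [← AlgHom.coe_toLinearMap, ← rTensor_ofMatrix, hM x y, rTensor_lie]

variable [DecidableEq ι]

theorem ofMatrix_one (x : g) : ofMatrix b (1 : Matrix ι ι A) x = 1 ⊗ₜ x := by
  refine LinearMap.congr_fun (g := TensorProduct.mk K A g 1) (b.ext fun i => ?_) x
  simp [ofMatrix_basis, Matrix.one_apply, TensorProduct.ite_tmul]

theorem isLieMatrix_one : IsLieMatrix b (1 : Matrix ι ι A) := by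
  intro x y
  simp [ofMatrix_one, LieAlgebra.ExtendScalars.bracket_tmul]

theorem IsLieMatrix.of_mul_eq_one {M N : Matrix ι ι A} (hM : IsLieMatrix b M) (h : M * N = 1) :
    IsLieMatrix b N := by
  have h' : N * M = 1 := mul_eq_one_comm.mp h
  have hinv (P Q : Matrix ι ι A) (hPQ : P * Q = 1) (z : A ⊗[K] g) :
      (ofMatrix b Q).liftBaseChange A ((ofMatrix b P).liftBaseChange A z) = z := by
    induction z with
    | zero => simp
    | add x₁ x₂ h₁ h₂ => simp only [map_add, h₁, h₂]
    | tmul a u =>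
      simp [liftBaseChange_ofMatrix, hPQ, ofMatrix_one, TensorProduct.smul_tmul']
  intro x y
  have hx (x : g) : (ofMatrix b M).liftBaseChange A (ofMatrix b N x) = 1 ⊗ₜ x := by
    rw [liftBaseChange_ofMatrix, h', ofMatrix_one]
  rw [← hinv M N h ⁅ofMatrix b N x, ofMatrix b N y⁆, hM.liftBaseChange_lie, hx, hx,
    LieAlgebra.ExtendScalars.bracket_tmul]
  simp

variable (K ι) in
/-- A generic matrix. -/
noncomputable def genericMatrix : Matrix ι ι (MvPolynomial ((ι × ι) ⊕ (ι × ι)) K) :=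
  Matrix.of fun i j => .X (.inl (i, j))

variable (K ι) in
/-- A second generic matrix, with entries independent of those of `genericMatrix`. -/
noncomputable def genericInverse : Matrix ι ι (MvPolynomial ((ι × ι) ⊕ (ι × ι)) K) :=
  Matrix.of fun i j => .X (.inr (i, j))

/-- The ideal of relations `X * Y = 1` and of `X` being a Lie matrix between the entries of two generic
matrices `X` and `Y`. -/
noncomputable def autIdeal : Ideal (MvPolynomial ((ι × ι) ⊕ (ι × ι)) K) :=
  Ideal.span ({p | ∃ i j, p = (genericMatrix K ι * genericInverse K ι - 1) i j} ∪
    {p | ∃ i j l, p = (Algebra.TensorProduct.basis _ b).repr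
      (ofMatrix b (genericMatrix K ι) ⁅b i, b j⁆ -
        ⁅ofMatrix b (genericMatrix K ι) (b i), ofMatrix b (genericMatrix K ι) (b j)⁆) l})

/-- The coordinate algebra of the automorphism group scheme of `g`. -/
def AutCoord : Type u := MvPolynomial ((ι × ι) ⊕ (ι × ι)) K ⧸ autIdeal b

namespace AutCoord

noncomputable instance : CommRing (AutCoord b) :=
  inferInstanceAs (CommRing (MvPolynomial ((ι × ι) ⊕ (ι × ι)) K ⧸ autIdeal b))

noncomputable instance : Algebra K (AutCoord b) :=
  inferInstanceAs (Algebra K (MvPolynomial ((ι × ι) ⊕ (ι × ι)) K ⧸ autIdeal b))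

/-- The quotient map onto `AutCoord b`. -/
noncomputable def mk : MvPolynomial ((ι × ι) ⊕ (ι × ι)) K →ₐ[K] AutCoord b :=
  Ideal.Quotient.mkₐ K (autIdeal b)

theorem mk_eq_zero {p : MvPolynomial ((ι × ι) ⊕ (ι × ι)) K} (hp : p ∈ autIdeal b) :
    mk b p = 0 :=
  Ideal.Quotient.eq_zero_iff_mem.mpr hp

/-- The generic automorphism. -/
noncomputable def gen : Matrix ι ι (AutCoord b) := (genericMatrix K ι).map (mk b)

/-- The inverse of the generic automorphism. -/
noncomputable def genInv : Matrix ι ι (AutCoord b) := (genericInverse K ι).map (mk b)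

theorem gen_mul_genInv : gen b * genInv b = 1 := by
  rw [gen, genInv, ← Matrix.map_mul, ← Matrix.map_one (mk b) (map_zero _) (map_one _)]
  ext i j
  have := mk_eq_zero b (Ideal.subset_span (Or.inl ⟨i, j, rfl⟩))
  rwa [Matrix.sub_apply, map_sub, sub_eq_zero] at this

theorem isLieMatrix_gen : IsLieMatrix b (gen b) := by
  rw [isLieMatrix_iff]
  intro i j l
  have := mk_eq_zero b (Ideal.subset_span (Or.inr ⟨i, j, l, rfl⟩))
  rwa [← basis_repr_rTensor, map_sub, rTensor_lie, rTensor_ofMatrix, rTensor_ofMatrix,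
    rTensor_ofMatrix] at this

variable {b} in
/-- An invertible Lie matrix over `A` defines an `A`-point of `AutCoord b`. -/
noncomputable def lift (M N : Matrix ι ι A) (h : M * N = 1) (hM : IsLieMatrix b M) :
    AutCoord b →ₐ[K] A :=
  Ideal.Quotient.liftₐ (autIdeal b)
    (MvPolynomial.aeval (Sum.elim (fun p => M p.1 p.2) (fun p => N p.1 p.2))) <| by
    set φ : MvPolynomial ((ι × ι) ⊕ (ι × ι)) K →ₐ[K] A :=
      MvPolynomial.aeval (Sum.elim (fun p => M p.1 p.2) (fun p => N p.1 p.2)) with hφ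
    have hX : (genericMatrix K ι).map φ = M := by ext; simp [hφ, genericMatrix]
    have hY : (genericInverse K ι).map φ = N := by ext; simp [hφ, genericInverse]
    change autIdeal b ≤ RingHom.ker φ
    rw [autIdeal, Ideal.span_le]
    rintro _ (⟨i, j, rfl⟩ | ⟨i, j, l, rfl⟩)
    · rw [SetLike.mem_coe, RingHom.mem_ker, Matrix.sub_apply, map_sub, sub_eq_zero,
        ← Matrix.map_apply (f := φ), Matrix.map_mul, hX, hY, h, ← Matrix.map_apply (f := φ),
        Matrix.map_one φ (map_zero φ) (map_one φ)]
    · rw [SetLike.mem_coe, RingHom.mem_ker, ← basis_repr_rTensor, map_sub, rTensor_lie,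
        rTensor_ofMatrix, rTensor_ofMatrix, rTensor_ofMatrix, AlgHom.coe_toLinearMap, hX]
      exact (isLieMatrix_iff b M).mp hM i j l

theorem lift_gen (M N : Matrix ι ι A) (h : M * N = 1) (hM : IsLieMatrix b M) (i j : ι) :
    lift M N h hM (gen b i j) = M i j :=
  MvPolynomial.aeval_X _ _

variable {b} in
theorem algHom_ext {f f' : AutCoord b →ₐ[K] A} (h : (gen b).map f = (gen b).map f') : f = f' := by
  have key (f : AutCoord b →ₐ[K] A) : (gen b).map f * (genInv b).map f = 1 := by
    rw [← Matrix.map_mul, gen_mul_genInv]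
    simp
  have h' : (genInv b).map f = (genInv b).map f' :=
    left_inv_eq_right_inv (mul_eq_one_comm.mp (key f)) (h ▸ key f')
  refine Ideal.Quotient.algHom_ext K (MvPolynomial.algHom_ext ?_)
  rintro (⟨i, j⟩ | ⟨i, j⟩)
  · exact congr_fun₂ h i j
  · exact congr_fun₂ h' i j

open Algebra.TensorProduct (includeLeft includeRight)

theorem genInv_mul_gen : genInv b * gen b = 1 := mul_eq_one_comm.mp (gen_mul_genInv b)

/-- The comultiplication. -/
noncomputable def comul : AutCoord b →ₐ[K] AutCoord b ⊗[K] AutCoord b :=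
  let l : AutCoord b →ₐ[K] AutCoord b ⊗[K] AutCoord b := includeLeft
  let r : AutCoord b →ₐ[K] AutCoord b ⊗[K] AutCoord b := includeRight
  lift ((gen b).map l * (gen b).map r) ((genInv b).map r * (genInv b).map l)
    (by
      rw [Matrix.mul_assoc, ← Matrix.mul_assoc ((gen b).map r), ← Matrix.map_mul, gen_mul_genInv,
        Matrix.map_one _ (map_zero r) (map_one r), Matrix.one_mul, ← Matrix.map_mul,
        gen_mul_genInv, Matrix.map_one _ (map_zero l) (map_one l)])
    (((isLieMatrix_gen b).map b l).mul b ((isLieMatrix_gen b).map b r))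

/-- The counit. -/
noncomputable def counit : AutCoord b →ₐ[K] K :=
  lift 1 1 (one_mul 1) (isLieMatrix_one b)

/-- The antipode. -/
noncomputable def antipode : AutCoord b →ₐ[K] AutCoord b :=
  lift (genInv b) (gen b) (genInv_mul_gen b)
    ((isLieMatrix_gen b).of_mul_eq_one b (gen_mul_genInv b))

theorem comul_gen (i j : ι) : comul b (gen b i j) = ∑ k, gen b i k ⊗ₜ gen b k j := by
  rw [comul, lift_gen]
  simp [Matrix.mul_apply]

theorem counit_gen (i j : ι) : counit b (gen b i j) = (1 : Matrix ι ι K) i j := by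
  rw [counit, lift_gen]

theorem antipode_gen (i j : ι) : antipode b (gen b i j) = genInv b i j := by
  rw [antipode, lift_gen]

noncomputable instance : Bialgebra K (AutCoord b) :=
  Bialgebra.ofAlgHom (comul b) (counit b)
    (algHom_ext <| by
      ext i j
      simp [comul_gen, TensorProduct.sum_tmul, TensorProduct.tmul_sum]
      exact Finset.sum_comm)
    (algHom_ext <| by
      ext i j
      simp [comul_gen, counit_gen, Matrix.one_apply, TensorProduct.ite_tmul])
    (algHom_ext <| by
      ext i j
      simp [comul_gen, counit_gen, Matrix.one_apply, TensorProduct.tmul_ite])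

theorem comulAlgHom_gen (i j : ι) :
    Bialgebra.comulAlgHom K (AutCoord b) (gen b i j) = ∑ k, gen b i k ⊗ₜ gen b k j :=
  comul_gen b i j

theorem counitAlgHom_gen (i j : ι) :
    Bialgebra.counitAlgHom K (AutCoord b) (gen b i j) = (1 : Matrix ι ι K) i j :=
  counit_gen b i j

noncomputable instance : HopfAlgebra K (AutCoord b) :=
  HopfAlgebra.ofAlgHom (antipode b)
    (algHom_ext <| by
      ext i j
      have := congr_fun₂ (genInv_mul_gen b) i j
      rw [Matrix.mul_apply] at this
      simp only [Matrix.map_apply, AlgHom.comp_apply, comulAlgHom_gen, counitAlgHom_gen, map_sum]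
      refine (Finset.sum_congr rfl fun k _ => ?_).trans (this.trans ?_)
      · change antipode b (gen b i k) * gen b k j = _
        rw [antipode_gen]
      · simp only [Matrix.one_apply]
        split_ifs <;> simp)
    (algHom_ext <| by
      ext i j
      have := congr_fun₂ (gen_mul_genInv b) i j
      rw [Matrix.mul_apply] at this
      simp only [Matrix.map_apply, AlgHom.comp_apply, comulAlgHom_gen, counitAlgHom_gen, map_sum,
        Algebra.TensorProduct.lift_tmul, antipode_gen, AlgHom.id_apply, this, Matrix.one_apply]
      split_ifs <;> simp)

end AutCoord

section Comodule

variable {C : Type u} [CommRing C]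

theorem isLieCoaction_iff [Bialgebra K C] (η : g →ₗ⁅K⁆ C ⊗[K] g) (M : Matrix ι ι C)
    (hM : η.toLinearMap = ofMatrix b M) :
    IsLieCoaction K g C η ↔ (∀ i j, Coalgebra.counit (R := K) (M i j) = (1 : Matrix ι ι K) i j) ∧
      ∀ i j, Coalgebra.comul (R := K) (M i j) = ∑ k, M i k ⊗ₜ[K] M k j := by
  have hη (x : g) : η x = ofMatrix b M x := LinearMap.congr_fun hM x
  refine and_congr ?_ ?_
  · calc
      _ ↔ (∀ x : g, ofMatrix b (M.map (Coalgebra.counit (R := K))) x =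
            ofMatrix b (1 : Matrix ι ι K) x) := by
        refine forall_congr' fun x => ?_
        rw [hη, rTensor_ofMatrix, ofMatrix_one, ← (TensorProduct.lid K g).injective.eq_iff]
        simp
      _ ↔ _ := by
        rw [← LinearMap.ext_iff, (ofMatrix_injective b).eq_iff, ← Matrix.ext_iff]
        rfl
  · have key : (TensorProduct.assoc K C C g).symm.toLinearMap ∘ₗ
        LinearMap.lTensor C η.toLinearMap ∘ₗ η.toLinearMap =
        ofMatrix b (Matrix.of fun i j => ∑ k, M i k ⊗ₜ[K] M k j) := by
      refine b.ext fun i => ?_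
      rw [hM]
      simp [ofMatrix_basis, TensorProduct.tmul_sum, TensorProduct.sum_tmul]
      exact Finset.sum_comm
    calc
      _ ↔ (∀ x : g, ofMatrix b (M.map (Coalgebra.comul (R := K))) x =
            ofMatrix b (Matrix.of fun i j => ∑ k, M i k ⊗ₜ[K] M k j) x) := by
        refine forall_congr' fun x => ?_
        rw [← key, hη, rTensor_ofMatrix, ← hη]
        rfl
      _ ↔ _ := by
        rw [← LinearMap.ext_iff, (ofMatrix_injective b).eq_iff, ← Matrix.ext_iff]
        rfl

theorem mul_map_antipode_eq_one [HopfAlgebra K C] (M : Matrix ι ι C)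
    (hε : ∀ i j, Coalgebra.counit (R := K) (M i j) = (1 : Matrix ι ι K) i j)
    (hΔ : ∀ i j, Coalgebra.comul (R := K) (M i j) = ∑ k, M i k ⊗ₜ[K] M k j) :
    M * M.map (HopfAlgebra.antipode K) = 1 := by
  ext i j
  have := HopfAlgebra.mul_antipode_lTensor_comul_apply (R := K) (M i j)
  rw [hΔ, hε] at this
  simpa [Matrix.mul_apply, Matrix.one_apply, apply_ite] using this

end Comodule

namespace AutCoord

/-- The universal coaction. -/
noncomputable def coaction : g →ₗ⁅K⁆ AutCoord b ⊗[K] g :=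
  { ofMatrix b (gen b) with map_lie' := fun {x y} => isLieMatrix_gen b x y }

theorem isLieCoaction_coaction : IsLieCoaction K g (AutCoord b) (coaction b) :=
  (isLieCoaction_iff b (coaction b) (gen b) rfl).mpr ⟨counit_gen b, comul_gen b⟩

theorem existsUnique_bialgHom {C : Type u} [CommRing C] [HopfAlgebra K C]
    (ψ : g →ₗ⁅K⁆ C ⊗[K] g) (hψ : IsLieCoaction K g C ψ) :
    ∃! Φ : AutCoord b →ₐc[K] C,
      ∀ x : g, ψ x = LinearMap.rTensor g Φ.toLinearMap (coaction b x) := by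
  obtain ⟨M, hM⟩ : ∃ M : Matrix ι ι C, ψ.toLinearMap = ofMatrix b M :=
    ⟨_, (ofMatrix_toMatrix b ψ.toLinearMap).symm⟩
  obtain ⟨hε, hΔ⟩ := (isLieCoaction_iff b ψ M hM).mp hψ
  have hLie : IsLieMatrix b M := fun x y => by
    rw [← hM]
    exact ψ.map_lie x y
  have hfactor (Φ : AutCoord b →ₐc[K] C) :
      (∀ x : g, ψ x = LinearMap.rTensor g Φ.toLinearMap (coaction b x)) ↔
        M = (gen b).map Φ := by
    rw [← (ofMatrix_injective b).eq_iff, ← hM, LinearMap.ext_iff]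
    refine forall_congr' fun x => ?_
    change _ = LinearMap.rTensor g Φ.toLinearMap (ofMatrix b (gen b) x) ↔ _
    rw [rTensor_ofMatrix]
    rfl
  let f : AutCoord b →ₐ[K] C := lift M _ (mul_map_antipode_eq_one M hε hΔ) hLie
  have hf (i j : ι) : f (gen b i j) = M i j := lift_gen b _ _ _ _ i j
  refine ⟨BialgHom.ofAlgHom f (algHom_ext ?_) (algHom_ext ?_), (hfactor _).mpr ?_, ?_⟩
  · ext i j
    simp only [Matrix.map_apply, AlgHom.comp_apply, hf, counitAlgHom_gen]
    exact hε i j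
  · ext i j
    simp only [Matrix.map_apply, AlgHom.comp_apply, hf, comulAlgHom_gen, map_sum,
      Algebra.TensorProduct.map_tmul]
    exact (hΔ i j).symm
  · ext i j
    exact (hf i j).symm
  · intro Φ hΦ
    have h : (Φ : AutCoord b →ₐ[K] C) = f := algHom_ext <| by
      ext i j
      exact (congr_fun₂ ((hfactor Φ).mp hΦ) i j).symm.trans (hf i j).symm
    exact BialgHom.ext fun x => AlgHom.congr_fun h x

end AutCoord

end LieCoaction

/-- Every finite-dimensional Lie algebra over a field of characteristic zero admits a
universal coacting commutative Hopf algebra. -/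
theorem exists_universalCoactingHopfAlgebra
    (K : Type u) [Field K] [CharZero K]
    (g : Type u) [LieRing g] [LieAlgebra K g] [FiniteDimensional K g] :
    Nonempty (UniversalCoactingHopfAlgebra K g) :=
  let b := Module.finBasis K g
  ⟨{  H := LieCoaction.AutCoord b
      lam := LieCoaction.AutCoord.coaction b
      coaction := LieCoaction.AutCoord.isLieCoaction_coaction b
      universal := fun _ _ _ => LieCoaction.AutCoord.existsUnique_bialgHom b }⟩
end
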